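/- For every real a > 0, the function 𝔛(σ,τ,a) = −3a − 6a(σ + τ − 3στ + σ^2τ^2)/((1−σ)(1−τ)(1−στ)) satisfies, at every point (σ,τ) ∈ (0,1)^2, the partial differential equation 2·𝔛(σ,τ,a)^2 − 6( a σ ∂_σ 𝔛(σ,τ,a) + a τ ∂_τ 𝔛(σ,τ,a) ) + 27( 𝕽(σ,a) + 𝕽(τ,a) ) = 0. -/

import Mathlib

/-- `𝔛(σ,τ,a) = −3a − 6a(σ + τ − 3στ + σ²τ²)/((1−σ)(1−τ)(1−στ))`. -/
noncomputable def Xsig (a σ τ : ℝ) : ℝ :=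
  -3 * a - 6 * a * (σ + τ - 3 * σ * τ + σ ^ 2 * τ ^ 2) /
    ((1 - σ) * (1 - τ) * (1 - σ * τ))

/-- `𝕽(σ,a) = −a²(1 + 10σ + σ²)/(3(1−σ)²)`. -/
noncomputable def Rsig (a σ : ℝ) : ℝ :=
  -(a ^ 2 * (1 + 10 * σ + σ ^ 2)) / (3 * (1 - σ) ^ 2)

theorem Xsig_symm_aux (a σ τ : ℝ) : Xsig a σ τ = Xsig a τ σ := by
  unfold Xsig
  congr 1
  congr 1 <;> ring

theorem Xsig_hasDerivAt_aux (a σ τ : ℝ) (h1 : 1 - σ ≠ 0) (h2 : 1 - τ ≠ 0)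
    (h3 : 1 - σ * τ ≠ 0) :
    HasDerivAt (fun u : ℝ => Xsig a u τ)
      (-(6 * a * (1 - 3 * τ + 2 * σ * τ ^ 2) * ((1 - σ) * (1 - τ) * (1 - σ * τ)) -
        6 * a * (σ + τ - 3 * σ * τ + σ ^ 2 * τ ^ 2) *
          ((1 - τ) * (-(1 - σ * τ) - τ * (1 - σ)))) /
        ((1 - σ) * (1 - τ) * (1 - σ * τ)) ^ 2) σ := by
  have hx := hasDerivAt_id σ
  have hN := ((((hx.add_const τ).sub ((hx.const_mul 3).mul_const τ)).add
    ((hx.pow 2).mul_const (τ ^ 2))).const_mul (6 * a))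
  have hD := ((hx.const_sub 1).mul_const (1 - τ)).mul ((hx.mul_const τ).const_sub 1)
  have h := (hN.div hD (mul_ne_zero (mul_ne_zero h1 h2) h3)).const_sub (-3 * a)
  refine (h.congr_deriv ?_)
  simp
  rw [← neg_div]
  congr 1
  ring

/-- For every `a > 0`, the function `𝔛` satisfies, at every `(σ,τ) ∈ (0,1)²`, the PDE
`2𝔛² − 6(aσ ∂_σ𝔛 + aτ ∂_τ𝔛) + 27(𝕽(σ,a) + 𝕽(τ,a)) = 0`. -/
theorem Xsig_pde (a : ℝ) (ha : 0 < a) (σ τ : ℝ)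
    (hσ : σ ∈ Set.Ioo (0:ℝ) 1) (hτ : τ ∈ Set.Ioo (0:ℝ) 1) :
    2 * (Xsig a σ τ) ^ 2 -
      6 * (a * σ * deriv (fun u : ℝ => Xsig a u τ) σ +
           a * τ * deriv (fun v : ℝ => Xsig a σ v) τ) +
      27 * (Rsig a σ + Rsig a τ) = 0 := by
  have h1 : 1 - σ ≠ 0 := (sub_pos.2 hσ.2).ne'
  have h2 : 1 - τ ≠ 0 := (sub_pos.2 hτ.2).ne'
  have h3 : 1 - σ * τ ≠ 0 := by
    have : σ * τ < 1 := by nlinarith [hσ.1, hσ.2, hτ.1, hτ.2]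
    exact (sub_pos.2 this).ne'
  have h3' : 1 - τ * σ ≠ 0 := by rwa [mul_comm]
  have e : (fun v : ℝ => Xsig a σ v) = fun v => Xsig a v σ :=
    funext fun v => Xsig_symm_aux a σ v
  rw [e, (Xsig_hasDerivAt_aux a σ τ h1 h2 h3).deriv,
    (Xsig_hasDerivAt_aux a τ σ h2 h1 h3').deriv, mul_comm τ σ]
  unfold Xsig Rsig
  field_simp
  ring
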